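/- Let (L,T) be a Reynolds Lie–Yamaguti algebra of weight λ and (V;ρ,θ,T_V) a representation of it, with D(x,y) := θ(y,x) - θ(x,y) - ρ([x,y]) + ρ(x)ρ(y) - ρ(y)ρ(x). Let ν : L × L → V be bilinear, ψ : L × L × L → V trilinear and χ : L → V linear, and equip L ⊕ V with the operations [x+u, y+v]_ν := [x,y] + ρ(x)v - ρ(y)u + ν(x,y), {x+u, y+v, z+w}_ψ := {x,y,z} + θ(y,z)u - θ(x,z)v + D(x,y)w + ψ(x,y,z), and T_χ(x+u) := T(x) + χ(x) + T_V(u). Then (L ⊕ V, [-,-]_ν, {-,-,-}_ψ, T_χ) is a Reynolds Lie–Yamaguti algebra of weight λ if and only if the following hold for all x,y,z,a,b in L: (S) ν(x,y) = -ν(y,x) and ψ(x,y,z) = -ψ(y,x,z); (E1) the sum over cyclic permutations of (x,y,z) of -ρ(z)ν(x,y) + ν([x,y],z) + ψ(x,y,z) vanishes; (E2) the sum over cyclic permutations of (x,y,z) of θ(z,a)ν(x,y) + ψ([x,y],z,a) vanishes; (E3) D(a,b)ν(x,y) + ψ(a,b,[x,y]) = ν({a,b,x},y) + ν(x,{a,b,y})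 + ρ(x)ψ(a,b,y) - ρ(y)ψ(a,b,x); (E4) D(a,b)ψ(x,y,z) + ψ(a,b,{x,y,z}) = ψ({a,b,x},y,z) + ψ(x,{a,b,y},z) + ψ(x,y,{a,b,z}) + θ(y,z)ψ(a,b,x) - θ(x,z)ψ(a,b,y) + D(x,y)ψ(a,b,z); (E5) ν(Tx,Ty) + ρ(Tx)χ(y) - ρ(Ty)χ(x) = χ([Tx,y] + [x,Ty] + λ[Tx,Ty]) + T_V(ν(Tx,y) + ν(x,Ty) + λν(Tx,Ty)) + T_V(ρ(x)χ(y) - ρ(y)χ(x)) + λT_V(ρ(Tx)χ(y) - ρ(Ty)χ(x)); (E6) ψ(Tx,Ty,Tz) + θ(Ty,Tz)χ(x) - θ(Tx,Tz)χ(y) + D(Tx,Ty)χ(z) = χ({x,Ty,Tz} + {Tx,y,Tz} + {Tx,Ty,z} + 2λ{Tx,Ty,Tz}) + T_V(ψ(Tx,Ty,z) + ψ(Tx,y,Tz) + ψ(x,Ty,Tz) + 2λψ(Tx,Ty,Tz)) + T_V(θ(Ty,z)χ(x) + θ(y,Tz)χ(x) - θ(Tx,z)χ(y) - θ(x,Tz)χ(y)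 + D(Tx,y)χ(z) + D(x,Ty)χ(z) + 2λθ(Ty,Tz)χ(x) - 2λθ(Tx,Tz)χ(y) + 2λD(Tx,Ty)χ(z)). -/

import Mathlib

open Finset

variable (K : Type*) [Field K] [CharZero K]
variable {L : Type*} [AddCommGroup L] [Module K L]
variable {V : Type*} [AddCommGroup V] [Module K V]

/-- A Lie–Yamaguti algebra structure given by a bilinear bracket `br` and a
trilinear bracket `tr`, satisfying (LY1)–(LY6). -/
def IsLYAlgebra (br : L → L → L) (tr : L → L → L → L) : Prop :=
  (∀ y, IsLinearMap K fun x => br x y) ∧ (∀ x, IsLinearMap K (br x)) ∧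
  (∀ y z, IsLinearMap K fun x => tr x y z) ∧ (∀ x z, IsLinearMap K fun y => tr x y z) ∧
  (∀ x y, IsLinearMap K (tr x y)) ∧
  (∀ x y, br x y = - br y x) ∧
  (∀ x y z, tr x y z = - tr y x z) ∧
  (∀ x y z, br (br x y) z + br (br z x) y + br (br y z) x
      + tr x y z + tr z x y + tr y z x = 0) ∧
  (∀ x y z a, tr (br x y) z a + tr (br z x) y a + tr (br y z) x a = 0) ∧
  (∀ a b x y, tr a b (br x y) = br (tr a b x) y + br x (tr a b y)) ∧
  (∀ a b x y z, tr a b (tr x y z)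
      = tr (tr a b x) y z + tr x (tr a b y) z + tr x y (tr a b z))

/-- `T` is a Reynolds operator of weight `lam` on the Lie–Yamaguti algebra `(L, br, tr)`. -/
def IsReynoldsOp (lam : K) (br : L → L → L) (tr : L → L → L → L) (T : L → L) : Prop :=
  IsLinearMap K T ∧
  (∀ x y, br (T x) (T y) = T (br (T x) y + br x (T y) + lam • br (T x) (T y))) ∧
  (∀ x y z, tr (T x) (T y) (T z)
    = T (tr x (T y) (T z) + tr (T x) y (T z) + tr (T x) (T y) z
        + (2 * lam) • tr (T x) (T y) (T z)))

/-- The map `D(x,y) = θ(y,x) - θ(x,y) - ρ([x,y]) + ρ(x)ρ(y) - ρ(y)ρ(x)`. -/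
def DMap (br : L → L → L) (rho : L → V → V) (theta : L → L → V → V)
    (x y : L) (u : V) : V :=
  theta y x u - theta x y u - rho (br x y) u + rho x (rho y u) - rho y (rho x u)

/-- `(V; ρ, θ)` is a representation of the Lie–Yamaguti algebra `(L, br, tr)`. -/
def IsLYRep (br : L → L → L) (tr : L → L → L → L)
    (rho : L → V → V) (theta : L → L → V → V) : Prop :=
  (∀ u, IsLinearMap K fun x => rho x u) ∧ (∀ x, IsLinearMap K (rho x)) ∧
  (∀ y u, IsLinearMap K fun x => theta x y u) ∧
  (∀ x u, IsLinearMap K fun y => theta x y u) ∧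
  (∀ x y, IsLinearMap K (theta x y)) ∧
  (∀ x y a u, theta (br x y) a u = theta x a (rho y u) - theta y a (rho x u)) ∧
  (∀ a b x u, DMap br rho theta a b (rho x u)
      = rho x (DMap br rho theta a b u) + rho (tr a b x) u) ∧
  (∀ x a b u, theta x (br a b) u = rho a (theta x b u) - rho b (theta x a u)) ∧
  (∀ a b x y u, DMap br rho theta a b (theta x y u)
      = theta x y (DMap br rho theta a b u) + theta (tr a b x) y u + theta x (tr a b y) u) ∧
  (∀ a x y z u, theta a (tr x y z) u
      = theta y z (theta a x u) - theta x z (theta a y u)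
        + DMap br rho theta x y (theta a z u))

/-- `(V; ρ, θ, T_V)` is a representation of the Reynolds Lie–Yamaguti algebra
`(L, br, tr, T)` of weight `lam`. -/
def IsReynoldsRep (lam : K) (br : L → L → L) (tr : L → L → L → L) (T : L → L)
    (rho : L → V → V) (theta : L → L → V → V) (TV : V → V) : Prop :=
  IsLYRep K br tr rho theta ∧ IsLinearMap K TV ∧
  (∀ x u, rho (T x) (TV u)
      = TV (rho (T x) u + rho x (TV u) + lam • rho (T x) (TV u))) ∧
  (∀ x y u, theta (T x) (T y) (TV u)
      = TV (theta (T x) (T y) u + theta (T x) y (TV u) + theta x (T y) (TV u)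
          + (2 * lam) • theta (T x) (T y) (TV u)))

/-- The deformed binary bracket `[x,y]_T`. -/
def brT (lam : K) (br : L → L → L) (T : L → L) (x y : L) : L :=
  br (T x) y + br x (T y) + lam • br (T x) (T y)

/-- The deformed ternary bracket `{x,y,z}_T`. -/
def trT (lam : K) (tr : L → L → L → L) (T : L → L) (x y z : L) : L :=
  tr x (T y) (T z) + tr (T x) y (T z) + tr (T x) (T y) z
    + (2 * lam) • tr (T x) (T y) (T z)

/-- The deformed representation map `ρ_T`. -/
def rhoT (lam : K) (rho : L → V → V) (T : L → L) (TV : V → V) (x : L) (u : V) : V :=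
  rho (T x) u - TV (lam • rho (T x) u + rho x u)

/-- The deformed representation map `θ_T`. -/
def thetaT (lam : K) (theta : L → L → V → V) (T : L → L) (TV : V → V)
    (x y : L) (u : V) : V :=
  theta (T x) (T y) u
    - TV ((2 * lam) • theta (T x) (T y) u + theta (T x) y u + theta x (T y) u)

/-- The deformed map `D_T`. -/
def DT (lam : K) (br : L → L → L) (rho : L → V → V) (theta : L → L → V → V)
    (T : L → L) (TV : V → V) (x y : L) (u : V) : V :=
  DMap br rho theta (T x) (T y) u
    - TV ((2 * lam) • DMap br rho theta (T x) (T y) u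
        + DMap br rho theta x (T y) u + DMap br rho theta (T x) y u)

theorem exists_eq_linearMap₂ (R : Type*) [CommRing R] {M N P : Type*} [AddCommGroup M] [Module R M]
    [AddCommGroup N] [Module R N] [AddCommGroup P] [Module R P] {f : M → N → P}
    (h₁ : ∀ y, IsLinearMap R fun x => f x y) (h₂ : ∀ x, IsLinearMap R (f x)) :
    ∃ g : M →ₗ[R] N →ₗ[R] P, f = fun x y => g x y :=
  ⟨LinearMap.mk₂ R f (fun x x' y => (h₁ y).map_add x x') (fun c x y => (h₁ y).map_smul c x)
    (fun x => (h₂ x).map_add) (fun c x => (h₂ x).map_smul c), rfl⟩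

theorem exists_eq_linearMap₃ (R : Type*) [CommRing R] {M N P Q : Type*}
    [AddCommGroup M] [Module R M]
    [AddCommGroup N] [Module R N] [AddCommGroup P] [Module R P] [AddCommGroup Q] [Module R Q]
    {f : M → N → P → Q}
    (h₁ : ∀ y z, IsLinearMap R fun x => f x y z) (h₂ : ∀ x z, IsLinearMap R fun y => f x y z)
    (h₃ : ∀ x y, IsLinearMap R (f x y)) :
    ∃ g : M →ₗ[R] N →ₗ[R] P →ₗ[R] Q, f = fun x y z => g x y z :=
  ⟨{ toFun := fun x => LinearMap.mk₂ R (f x) (fun y y' z => (h₂ x z).map_add y y')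
        (fun c y z => (h₂ x z).map_smul c y) (fun y => (h₃ x y).map_add)
        (fun c y => (h₃ x y).map_smul c)
     map_add' := fun x x' => LinearMap.ext₂ fun y z => (h₁ y z).map_add x x'
     map_smul' := fun c x => LinearMap.ext₂ fun y z => (h₁ y z).map_smul c x }, rfl⟩

theorem exists_eq_linearMap (R : Type*) [CommRing R] {M N : Type*} [AddCommGroup M] [Module R M]
    [AddCommGroup N] [Module R N] {f : M → N} (h : IsLinearMap R f) :
    ∃ g : M →ₗ[R] N, f = fun x => g x :=
  ⟨h.mk' f, rfl⟩

section DMap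

variable {F L V : Type*} [Field F] [AddCommGroup L] [Module F L] [AddCommGroup V] [Module F V]
variable {br : L → L → L} {tr : L → L → L → L} {rho : L → V → V} {theta : L → L → V → V}

theorem DMap_exists_eq_linearMap₃ (hLY : IsLYAlgebra F br tr) (h : IsLYRep F br tr rho theta) :
    ∃ D : L →ₗ[F] L →ₗ[F] V →ₗ[F] V, DMap br rho theta = fun x y u => D x y u := by
  obtain ⟨hb₁, hb₂, -⟩ := hLY
  obtain ⟨hr₁, hr₂, ht₁, ht₂, ht₃, -⟩ := h
  obtain ⟨br, rfl⟩ := exists_eq_linearMap₂ F hb₁ hb₂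
  obtain ⟨rho, rfl⟩ := exists_eq_linearMap₂ F hr₁ hr₂
  obtain ⟨theta, rfl⟩ := exists_eq_linearMap₃ F ht₁ ht₂ ht₃
  refine exists_eq_linearMap₃ F (fun y u => ⟨fun x x' => ?_, fun c x => ?_⟩)
    (fun x u => ⟨fun y y' => ?_, fun c y => ?_⟩) (fun x y => ⟨fun u u' => ?_, fun c u => ?_⟩) <;>
  · simp only [DMap, map_add, map_smul, LinearMap.add_apply, LinearMap.smul_apply]
    module

theorem DMap_skew (hLY : IsLYAlgebra F br tr) (h : IsLYRep F br tr rho theta) (x y : L) (u : V) :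
    DMap br rho theta x y u = -DMap br rho theta y x u := by
  have hneg : rho (br x y) u = -rho (br y x) u := by
    rw [hLY.2.2.2.2.2.1 x y, (h.1 u).map_neg]
  simp only [DMap, hneg]
  abel

theorem DMap_bracket_cyclic (hLY : IsLYAlgebra F br tr) (h : IsLYRep F br tr rho theta)
    (x y z : L) (u : V) :
    DMap br rho theta (br x y) z u + DMap br rho theta (br z x) y u
      + DMap br rho theta (br y z) x u = 0 := by
  obtain ⟨-, -, -, -, -, -, -, hjac, -⟩ := hLY
  obtain ⟨hr₁, hr₂, ht₁, ht₂, ht₃, h₁, h₂, h₃, -⟩ := h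
  obtain ⟨rho, rfl⟩ := exists_eq_linearMap₂ F hr₁ hr₂
  obtain ⟨theta, rfl⟩ := exists_eq_linearMap₃ F ht₁ ht₂ ht₃
  have hj := congrArg (fun w => rho w u) (hjac x y z)
  simp only [map_add, LinearMap.add_apply, map_zero, LinearMap.zero_apply] at hj
  have e₁ := h₂ x y z u
  have e₂ := h₂ z x y u
  have e₃ := h₂ y z x u
  simp only [DMap, map_add, map_sub] at e₁ e₂ e₃ ⊢
  linear_combination (norm := module) -hj - e₁ - e₂ - e₃ + h₃ z x y u + h₃ y z x u + h₃ x y z u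
    - h₁ x y z u - h₁ z x y u - h₁ y z x u

theorem DMap_comm_DMap (hLY : IsLYAlgebra F br tr) (h : IsLYRep F br tr rho theta)
    (a b x y : L) (u : V) :
    DMap br rho theta a b (DMap br rho theta x y u)
      = DMap br rho theta x y (DMap br rho theta a b u) + DMap br rho theta (tr a b x) y u
        + DMap br rho theta x (tr a b y) u := by
  obtain ⟨D, hD⟩ := DMap_exists_eq_linearMap₃ hLY h
  have hD' (x y u) : D x y u = theta y x u - theta x y u - rho (br x y) u
      + rho x (rho y u) - rho y (rho x u) := (congrFun (congrFun (congrFun hD x) y) u).symm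
  obtain ⟨-, -, -, -, -, -, -, -, -, hder, -⟩ := hLY
  obtain ⟨hr₁, hr₂, -, -, -, -, h₂, -, h₄, -⟩ := h
  obtain ⟨rho, rfl⟩ := exists_eq_linearMap₂ F hr₁ hr₂
  simp only [hD] at h₂ h₄ ⊢
  have e := congrArg (fun w => rho w u) (hder a b x y)
  simp only [map_add, LinearMap.add_apply] at e
  have e₁ := congrArg (rho x) (h₂ a b y u)
  have e₂ := congrArg (rho y) (h₂ a b x u)
  simp only [map_add] at e₁ e₂
  rw [hD' x y u, hD' x y (D a b u), hD' (tr a b x) y u, hD' x (tr a b y) u]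
  simp only [map_add, map_sub]
  linear_combination (norm := module) h₄ a b y x u - h₄ a b x y u - h₂ a b (br x y) u
    + h₂ a b x (rho y u) - h₂ a b y (rho x u) + e₁ - e₂ - e

theorem DMap_reynolds {lam : F} {T : L → L} {TV : V → V}
    (hT : IsReynoldsOp F lam br tr T) (h : IsReynoldsRep F lam br tr T rho theta TV)
    (x y : L) (u : V) :
    DMap br rho theta (T x) (T y) (TV u)
      = TV (DMap br rho theta (T x) (T y) u + DMap br rho theta (T x) y (TV u)
          + DMap br rho theta x (T y) (TV u)
          + (2 * lam) • DMap br rho theta (T x) (T y) (TV u)) := by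
  obtain ⟨-, hTb, -⟩ := hT
  obtain ⟨⟨hr₁, hr₂, -⟩, hTV, hρ, hθ⟩ := h
  obtain ⟨rho, rfl⟩ := exists_eq_linearMap₂ F hr₁ hr₂
  obtain ⟨TV, rfl⟩ := exists_eq_linearMap F hTV
  have e₁ := hρ x (rho (T y) u + rho y (TV u) + lam • rho (T y) (TV u))
  have e₂ := hρ y (rho (T x) u + rho x (TV u) + lam • rho (T x) (TV u))
  have e₃ := hρ (br (T x) y + br x (T y) + lam • br (T x) (T y)) u
  simp only [← hTb, ← hρ] at e₁ e₂ e₃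
  have f₁ := hθ x y u
  have f₂ := hθ y x u
  simp only [DMap, map_add, map_sub, map_smul, LinearMap.add_apply, LinearMap.smul_apply]
    at e₁ e₂ e₃ f₁ f₂ ⊢
  linear_combination (norm := module) f₂ - f₁ - e₃ + e₁ - e₂

end DMap

set_option maxHeartbeats 1000000 in
/-- `(L ⊕ V, [-,-]_ν, {-,-,-}_ψ, T_χ)` is a Reynolds Lie–Yamaguti algebra
of weight `lam` if and only if `((ν,ψ),χ)` is a 2-cocycle. -/
theorem stmt8 (lam : K) (br : L → L → L) (tr : L → L → L → L) (T : L → L)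
    (rho : L → V → V) (theta : L → L → V → V) (TV : V → V)
    (hLY : IsLYAlgebra K br tr) (hT : IsReynoldsOp K lam br tr T)
    (hrep : IsReynoldsRep K lam br tr T rho theta TV)
    (nu : L → L → V) (psi : L → L → L → V) (chi : L → V)
    (hnu₁ : ∀ y, IsLinearMap K fun x => nu x y) (hnu₂ : ∀ x, IsLinearMap K (nu x))
    (hpsi₁ : ∀ y z, IsLinearMap K fun x => psi x y z)
    (hpsi₂ : ∀ x z, IsLinearMap K fun y => psi x y z)
    (hpsi₃ : ∀ x y, IsLinearMap K (psi x y))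
    (hchi : IsLinearMap K chi) :
    (IsLYAlgebra (L := L × V) K
        (fun a b => (br a.1 b.1, rho a.1 b.2 - rho b.1 a.2 + nu a.1 b.1))
        (fun a b c => (tr a.1 b.1 c.1,
          theta b.1 c.1 a.2 - theta a.1 c.1 b.2 + DMap br rho theta a.1 b.1 c.2
            + psi a.1 b.1 c.1)) ∧
      IsReynoldsOp (L := L × V) K lam
        (fun a b => (br a.1 b.1, rho a.1 b.2 - rho b.1 a.2 + nu a.1 b.1))
        (fun a b c => (tr a.1 b.1 c.1,
          theta b.1 c.1 a.2 - theta a.1 c.1 b.2 + DMap br rho theta a.1 b.1 c.2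
            + psi a.1 b.1 c.1))
        (fun a => (T a.1, chi a.1 + TV a.2)))
    ↔
    ((∀ x y, nu x y = - nu y x) ∧ (∀ x y z, psi x y z = - psi y x z) ∧
      (∀ x y z,
        (- rho z (nu x y) + nu (br x y) z + psi x y z)
          + (- rho y (nu z x) + nu (br z x) y + psi z x y)
          + (- rho x (nu y z) + nu (br y z) x + psi y z x) = 0) ∧
      (∀ x y z a,
        (theta z a (nu x y) + psi (br x y) z a)
          + (theta y a (nu z x) + psi (br z x) y a)
          + (theta x a (nu y z) + psi (br y z) x a) = 0) ∧
      (∀ a b x y,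
        DMap br rho theta a b (nu x y) + psi a b (br x y)
          = nu (tr a b x) y + nu x (tr a b y) + rho x (psi a b y) - rho y (psi a b x)) ∧
      (∀ a b x y z,
        DMap br rho theta a b (psi x y z) + psi a b (tr x y z)
          = psi (tr a b x) y z + psi x (tr a b y) z + psi x y (tr a b z)
            + theta y z (psi a b x) - theta x z (psi a b y)
            + DMap br rho theta x y (psi a b z)) ∧
      (∀ x y,
        nu (T x) (T y) + rho (T x) (chi y) - rho (T y) (chi x)
          = chi (br (T x) y + br x (T y) + lam • br (T x) (T y))
            + TV (nu (T x) y + nu x (T y) + lam • nu (T x) (T y))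
            + TV (rho x (chi y) - rho y (chi x))
            + lam • TV (rho (T x) (chi y) - rho (T y) (chi x))) ∧
      (∀ x y z,
        psi (T x) (T y) (T z) + theta (T y) (T z) (chi x) - theta (T x) (T z) (chi y)
            + DMap br rho theta (T x) (T y) (chi z)
          = chi (tr x (T y) (T z) + tr (T x) y (T z) + tr (T x) (T y) z
                + (2 * lam) • tr (T x) (T y) (T z))
            + TV (psi (T x) (T y) z + psi (T x) y (T z) + psi x (T y) (T z)
                + (2 * lam) • psi (T x) (T y) (T z))
            + TV (theta (T y) z (chi x) + theta y (T z) (chi x)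
                - theta (T x) z (chi y) - theta x (T z) (chi y)
                + DMap br rho theta (T x) y (chi z) + DMap br rho theta x (T y) (chi z)
                + (2 * lam) • theta (T y) (T z) (chi x)
                - (2 * lam) • theta (T x) (T z) (chi y)
                + (2 * lam) • DMap br rho theta (T x) (T y) (chi z)))) := by
  have hDskew := DMap_skew hLY hrep.1
  have hDcyc := DMap_bracket_cyclic hLY hrep.1
  have hDD := DMap_comm_DMap hLY hrep.1
  have hDT := DMap_reynolds hT hrep
  have hDdef (x y : L) (u : V) : DMap br rho theta x y u = theta y x u - theta x y u
      - rho (br x y) u + rho x (rho y u) - rho y (rho x u) := rfl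
  obtain ⟨D, hD⟩ := DMap_exists_eq_linearMap₃ hLY hrep.1
  unfold IsReynoldsRep IsLYRep at hrep
  unfold IsReynoldsOp at hT ⊢
  unfold IsLYAlgebra at hLY ⊢
  simp only [hD] at hrep hDskew hDcyc hDD hDT hDdef ⊢
  clear hD
  obtain ⟨hb₁, hb₂, ht₁, ht₂, ht₃, hbskew, htskew, hLY3, hLY4, hLY5, hLY6⟩ := hLY
  obtain ⟨hTlin, hTb, hTt⟩ := hT
  obtain ⟨⟨hr₁, hr₂, hθ₁, hθ₂, hθ₃, hR1, hR2, hR3, hR4, hR5⟩, hTV, hTVρ, hTVθ⟩ := hrep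
  obtain ⟨br, rfl⟩ := exists_eq_linearMap₂ K hb₁ hb₂
  obtain ⟨tr, rfl⟩ := exists_eq_linearMap₃ K ht₁ ht₂ ht₃
  obtain ⟨rho, rfl⟩ := exists_eq_linearMap₂ K hr₁ hr₂
  obtain ⟨theta, rfl⟩ := exists_eq_linearMap₃ K hθ₁ hθ₂ hθ₃
  obtain ⟨nu, rfl⟩ := exists_eq_linearMap₂ K hnu₁ hnu₂
  obtain ⟨psi, rfl⟩ := exists_eq_linearMap₃ K hpsi₁ hpsi₂ hpsi₃
  obtain ⟨chi, rfl⟩ := exists_eq_linearMap K hchi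
  obtain ⟨T, rfl⟩ := exists_eq_linearMap K hTlin
  obtain ⟨TV, rfl⟩ := exists_eq_linearMap K hTV
  clear hb₁ hb₂ ht₁ ht₂ ht₃ hr₁ hr₂ hθ₁ hθ₂ hθ₃ hnu₁ hnu₂ hpsi₁ hpsi₂ hpsi₃ hchi hTlin hTV
  beta_reduce at *
  constructor
  · rintro ⟨⟨-, -, -, -, -, g1, g2, g3, g4, g5, g6⟩, -, g7, g8⟩
    refine ⟨fun x y => ?_, fun x y z => ?_, fun x y z => ?_, fun x y z a => ?_,
      fun a b x y => ?_, fun a b x y z => ?_, fun x y => ?_, fun x y z => ?_⟩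
    · have g := congrArg Prod.snd (g1 (x, 0) (y, 0))
      simpa using g
    · have g := congrArg Prod.snd (g2 (x, 0) (y, 0) (z, 0))
      simpa using g
    · have g := congrArg Prod.snd (g3 (x, 0) (y, 0) (z, 0))
      simp at g
      linear_combination (norm := module) g
    · have g := congrArg Prod.snd (g4 (x, 0) (y, 0) (z, 0) (a, 0))
      simp at g
      linear_combination (norm := module) g
    · have g := congrArg Prod.snd (g5 (a, 0) (b, 0) (x, 0) (y, 0))
      simp at g
      linear_combination (norm := module) g
    · have g := congrArg Prod.snd (g6 (a, 0) (b, 0) (x, 0) (y, 0) (z, 0))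
      simp at g
      linear_combination (norm := module) g
    · have g := congrArg Prod.snd (g7 (x, 0) (y, 0))
      simp at g
      simp only [map_add, map_sub, map_smul]
      linear_combination (norm := module) g
    · have g := congrArg Prod.snd (g8 (x, 0) (y, 0) (z, 0))
      simp at g
      simp only [map_add, map_sub, map_smul]
      linear_combination (norm := module) g
  · rintro ⟨s1, s2, E1, E2, E3, E4, E5, E6⟩
    refine ⟨⟨fun y => ⟨fun x x' => ?_, fun c x => ?_⟩, fun x => ⟨fun y y' => ?_, fun c y => ?_⟩,
      fun y z => ⟨fun x x' => ?_, fun c x => ?_⟩, fun x z => ⟨fun y y' => ?_, fun c y => ?_⟩,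
      fun x y => ⟨fun z z' => ?_, fun c z => ?_⟩, ?_, ?_, ?_, ?_, ?_, ?_⟩,
      ⟨fun x x' => ?_, fun c x => ?_⟩, ?_, ?_⟩
    iterate 10
      refine Prod.ext (by simp) ?_
      simp only [Prod.fst_add, Prod.snd_add, Prod.smul_fst, Prod.smul_snd, map_add, map_smul,
        LinearMap.add_apply, LinearMap.smul_apply]
      module
    · rintro ⟨x, u⟩ ⟨y, v⟩
      refine Prod.ext (hbskew x y) ?_
      simp only [Prod.snd_neg]
      linear_combination (norm := module) s1 x y
    · rintro ⟨x, u⟩ ⟨y, v⟩ ⟨z, w⟩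
      refine Prod.ext (htskew x y z) ?_
      simp only [Prod.snd_neg]
      linear_combination (norm := module) s2 x y z + hDskew x y w
    · rintro ⟨x, u⟩ ⟨y, v⟩ ⟨z, w⟩
      refine Prod.ext (hLY3 x y z) ?_
      simp only [Prod.snd_add, Prod.snd_zero, map_add, map_sub]
      linear_combination (norm := module) E1 x y z + hDdef x y w + hDdef z x v + hDdef y z u
    · rintro ⟨x, u⟩ ⟨y, v⟩ ⟨z, w⟩ ⟨a, c⟩
      refine Prod.ext (hLY4 x y z a) ?_
      simp only [Prod.snd_add, Prod.snd_zero, map_add, map_sub]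
      linear_combination (norm := module) E2 x y z a + hDcyc x y z c - hR1 x y a w - hR1 z x a v
        - hR1 y z a u
    · rintro ⟨a, c⟩ ⟨b, d⟩ ⟨x, u⟩ ⟨y, v⟩
      refine Prod.ext (hLY5 a b x y) ?_
      simp only [Prod.snd_add, map_add, map_sub]
      linear_combination (norm := module) E3 a b x y + hR2 a b x v - hR2 a b y u + hR3 b x y c
        - hR3 a x y d
    · rintro ⟨a, c⟩ ⟨b, d⟩ ⟨x, u⟩ ⟨y, v⟩ ⟨z, w⟩
      refine Prod.ext (hLY6 a b x y z) ?_
      simp only [Prod.snd_add, map_add, map_sub]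
      linear_combination (norm := module) E4 a b x y z + hR4 a b y z u - hR4 a b x z v
        + hDD a b x y w + hR5 b x y z c - hR5 a x y z d
    iterate 2
      refine Prod.ext (by simp) ?_
      simp only [Prod.fst_add, Prod.snd_add, Prod.smul_fst, Prod.smul_snd, map_add, map_smul]
      module
    · rintro ⟨x, u⟩ ⟨y, v⟩
      refine Prod.ext (hTb x y) ?_
      have e := E5 x y
      have e₁ := hTVρ x v
      have e₂ := hTVρ y u
      simp only [Prod.fst_add, Prod.snd_add, Prod.smul_fst, Prod.smul_snd, map_add, map_sub,
        map_smul] at e e₁ e₂ ⊢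
      linear_combination (norm := module) e + e₁ - e₂
    · rintro ⟨x, u⟩ ⟨y, v⟩ ⟨z, w⟩
      refine Prod.ext (hTt x y z) ?_
      have e := E6 x y z
      have e₁ := hTVθ y z u
      have e₂ := hTVθ x z v
      have e₃ := hDT x y w
      simp only [Prod.fst_add, Prod.snd_add, Prod.smul_fst, Prod.smul_snd, map_add, map_sub,
        map_smul] at e e₁ e₂ e₃ ⊢
      linear_combination (norm := module) e + e₁ - e₂ + e₃
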